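/- arXiv:1211.4605 — 3 statements merged into one kernel-verified Lean document; each statement's English description precedes it below -/
import Mathlib

section
/- Let q ∈ (0,1) and φ ∈ ℝ. On ℓ²(ℤ₊), let Z₁₁, Z₂₁, Z₂₂ be the unique bounded operators with Z₁₁e_k = −q⁻¹e^{2iφ}√(1−q^{4k}) e_{k−1} (so Z₁₁e₀ = 0), Z₂₁e_k = q^{2k}e^{iφ}e_k, and Z₂₂e_k = √(1−q^{4k+4}) e_{k+1}. Then (Z₁₁, Z₂₁, Z₂₂) satisfies the Pol(Mat₂^sym)_q relations. (The phase e^{2iφ} on Z₁₁ follows the normalization of the paper's construction section.) -/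
open ContinuousLinearMap Complex

noncomputable section

/-- `ℓ²`-space over an index type, with complex coefficients. -/
abbrev L2 (ι : Type) [DecidableEq ι] : Type := lp (fun _ : ι => ℂ) 2

/-- The standard orthonormal basis vectors of `L2 ι`. -/
def e {ι : Type} [DecidableEq ι] (i : ι) : L2 ι := lp.single 2 i 1

/-- The defining relations of `Pol(Mat₂ˢʸᵐ)_q` for a triple of bounded operators
`Z₁₁, Z₂₁, Z₂₂` on a complex Hilbert space. -/
def PolMat2SymRel (q : ℝ) {H : Type} [NormedAddCommGroup H] [InnerProductSpace ℂ H]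
    [CompleteSpace H] (Z11 Z21 Z22 : H →L[ℂ] H) : Prop :=
  Z11 * Z21 = (q : ℂ) ^ 2 • (Z21 * Z11) ∧
  Z21 * Z22 = (q : ℂ) ^ 2 • (Z22 * Z21) ∧
  Z11 * Z22 - Z22 * Z11 = ((q : ℂ) * ((q : ℂ) ^ 2 - ((q : ℂ)⁻¹) ^ 2)) • (Z21 * Z21) ∧
  adjoint Z11 * Z11 =
      (q : ℂ) ^ 4 • (Z11 * adjoint Z11)
      - ((q : ℂ) * ((q : ℂ)⁻¹ - (q : ℂ)) * (1 + (q : ℂ) ^ 2) ^ 2) • (Z21 * adjoint Z21)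
      + (((q : ℂ)⁻¹ - (q : ℂ)) ^ 2 * (1 + (q : ℂ) ^ 2)) • (Z22 * adjoint Z22)
      + (1 - (q : ℂ) ^ 4) • (1 : H →L[ℂ] H) ∧
  adjoint Z11 * Z21 =
      (q : ℂ) ^ 2 • (Z21 * adjoint Z11)
      - ((q : ℂ) * ((q : ℂ)⁻¹ - (q : ℂ)) * ((q : ℂ)⁻¹ + (q : ℂ))) • (Z22 * adjoint Z21) ∧
  adjoint Z11 * Z22 = Z22 * adjoint Z11 ∧
  adjoint Z21 * Z22 = (q : ℂ) ^ 2 • (Z22 * adjoint Z21) ∧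
  adjoint Z21 * Z21 =
      (q : ℂ) ^ 2 • (Z21 * adjoint Z21) - (1 - (q : ℂ) ^ 2) • (Z22 * adjoint Z22)
      + (1 - (q : ℂ) ^ 2) • (1 : H →L[ℂ] H) ∧
  adjoint Z22 * Z22 = (q : ℂ) ^ 4 • (Z22 * adjoint Z22) + (1 - (q : ℂ) ^ 4) • (1 : H →L[ℂ] H)

theorem inner_e (i : ℕ) (x : L2 ℕ) : inner ℂ (e i) x = x i := by
  simp [e, lp.inner_single_left]

theorem inner_e_e (i j : ℕ) : inner ℂ (e i : L2 ℕ) (e j) = if i = j then 1 else 0 := by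
  rw [inner_e]
  by_cases h : i = j
  · subst h; simp [e]
  · simp [e, h]

/-- Bounded operators on `ℓ²` are determined by their values on the standard basis. -/
theorem clm_ext_e {S T : L2 ℕ →L[ℂ] L2 ℕ} (h : ∀ k, S (e k) = T (e k)) : S = T := by
  ext1 x
  have hx : HasSum (fun k => x k • (e k : L2 ℕ)) x := by
    simpa only [e, ← lp.single_smul, smul_eq_mul, mul_one] using
      lp.hasSum_single (p := 2) (by simp) x
  have hS := hx.mapL S
  have hT := hx.mapL T
  simp only [map_smul, h] at hS hT
  exact hS.unique hT

theorem adjoint_e_eq {T : L2 ℕ →L[ℂ] L2 ℕ} {k : ℕ} {y : L2 ℕ}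
    (h : ∀ j, inner ℂ (T (e j)) (e k) = inner ℂ (e j) y) : adjoint T (e k) = y := by
  ext j
  rw [← inner_e, adjoint_inner_right, h, inner_e]

/-- For `q ∈ (0,1)` and `φ ∈ ℝ`, the operators on `ℓ²(ℤ₊)` given by
`Z₁₁ e_k = −q⁻¹e^{2iφ}√(1−q^{4k}) e_{k−1}` (so `Z₁₁ e₀ = 0`, the coefficient vanishing at
`k = 0`), `Z₂₁ e_k = q^{2k}e^{iφ} e_k`, `Z₂₂ e_k = √(1−q^{4k+4}) e_{k+1}` satisfy the
`Pol(Mat₂ˢʸᵐ)_q` relations. -/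
theorem stmt3 (q : ℝ) (hq : q ∈ Set.Ioo (0 : ℝ) 1) (φ : ℝ)
    (Z11 Z21 Z22 : L2 ℕ →L[ℂ] L2 ℕ)
    (h11 : ∀ k : ℕ, Z11 (e k) =
      (-(q : ℂ)⁻¹ * Complex.exp (2 * φ * Complex.I)
        * ((Real.sqrt (1 - q ^ (4 * k)) : ℝ) : ℂ)) • e (k - 1))
    (h21 : ∀ k : ℕ, Z21 (e k) =
      (((q ^ (2 * k) : ℝ) : ℂ) * Complex.exp (φ * Complex.I)) • e k)
    (h22 : ∀ k : ℕ, Z22 (e k) = ((Real.sqrt (1 - q ^ (4 * k + 4)) : ℝ) : ℂ) • e (k + 1)) :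
    PolMat2SymRel q Z11 Z21 Z22 := by
  obtain ⟨hq0, hq1⟩ := hq
  have hqc : (q : ℂ) ≠ 0 := by exact_mod_cast hq0.ne'
  obtain ⟨a, ha⟩ : ∃ a : ℕ → ℝ, ∀ k, a k = Real.sqrt (1 - q ^ (4 * k)) := ⟨_, fun _ => rfl⟩
  have haa (k : ℕ) : (a k : ℂ) * a k = 1 - ((q : ℂ) ^ (2 * k)) ^ 2 := by
    have : a k * a k = 1 - (q ^ (2 * k)) ^ 2 := by
      rw [ha, Real.mul_self_sqrt (sub_nonneg.2 (pow_le_one₀ hq0.le hq1.le))]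
      ring
    exact_mod_cast this
  have hexp : Complex.exp (2 * φ * Complex.I) = Complex.exp (φ * Complex.I) ^ 2 := by
    rw [← Complex.exp_nat_mul]; congr 1; push_cast; ring
  have hconj : Complex.exp (φ * Complex.I) * (starRingEnd ℂ) (Complex.exp (φ * Complex.I)) = 1 := by
    rw [← Complex.exp_conj, ← Complex.exp_add]; simp
  rw [hexp] at h11
  generalize Complex.exp (φ * Complex.I) = u at h11 h21 hconj
  obtain ⟨v, hv⟩ : ∃ v, v = (starRingEnd ℂ) u := ⟨_, rfl⟩
  rw [← hv] at hconj
  have z11_zero : Z11 (e 0) = 0 := by simp [h11]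
  have z11_succ (k : ℕ) : Z11 (e (k + 1)) = (-(q : ℂ)⁻¹ * u ^ 2 * a (k + 1)) • e k := by
    rw [h11, ha, Nat.add_sub_cancel]
  have z21 (k : ℕ) : Z21 (e k) = ((q : ℂ) ^ (2 * k) * u) • e k := by
    rw [h21]; push_cast; rfl
  have z22 (k : ℕ) : Z22 (e k) = (a (k + 1) : ℂ) • e (k + 1) := by
    rw [h22, ha, mul_add, mul_one]
  have s11 (k : ℕ) : adjoint Z11 (e k) = (-(q : ℂ)⁻¹ * v ^ 2 * a (k + 1)) • e (k + 1) := by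
    refine adjoint_e_eq fun j => ?_
    rcases j with _ | j
    · simp only [z11_zero, inner_smul_right, inner_e_e, inner_zero_left]; simp
    · simp only [z11_succ, inner_smul_left, inner_smul_right, inner_e_e, hv]
      by_cases hjk : j = k <;> simp [hjk]
  have s21 (k : ℕ) : adjoint Z21 (e k) = ((q : ℂ) ^ (2 * k) * v) • e k := by
    refine adjoint_e_eq fun j => ?_
    simp only [z21, inner_smul_left, inner_smul_right, inner_e_e, hv]
    by_cases hjk : j = k <;> simp [hjk]
  have s22_zero : adjoint Z22 (e 0) = 0 := by
    refine adjoint_e_eq fun j => ?_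
    simp only [z22, inner_smul_left, inner_e_e, inner_zero_right]
    simp
  have s22_succ (k : ℕ) : adjoint Z22 (e (k + 1)) = (a (k + 1) : ℂ) • e k := by
    refine adjoint_e_eq fun j => ?_
    simp only [z22, inner_smul_left, inner_smul_right, inner_e_e]
    by_cases hjk : j = k <;> simp [hjk]
  have hp (k : ℕ) : (q : ℂ) ^ (2 * (k + 1)) = q ^ 2 * (q : ℂ) ^ (2 * k) := by ring
  have hb (k : ℕ) : (a (k + 1) : ℂ) ^ 2 = 1 - (q ^ 2 * (q : ℂ) ^ (2 * k)) ^ 2 := by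
    rw [sq, haa, hp]
  have hb0 : (a 1 : ℂ) ^ 2 = 1 - q ^ 4 := by
    rw [hb 0]; ring
  refine ⟨?_, ?_, ?_, ?_, ?_, ?_, ?_, ?_, ?_⟩ <;> refine clm_ext_e fun k => ?_ <;>
    rcases k with _ | k <;>
    simp only [mul_apply_eq_comp, _root_.add_apply,
      _root_.sub_apply, _root_.smul_apply,
      one_apply_eq_self, map_smul, map_zero, smul_zero, z11_zero, z11_succ, z21, z22,
      s11, s21, s22_zero, s22_succ, smul_smul, sub_zero, add_zero, hp, mul_zero, pow_zero,
      zero_add] <;>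
    try module
  all_goals
    try simp only [← sub_smul, ← add_smul]
    try rw [← zero_smul ℂ (e 0 : L2 ℕ)]
    congr 1
    first
    | have h1 := hb k
      have h2 := hb (k + 1)
      rw [hp] at h2
      clear * - hqc h1 h2 hconj
      generalize (a (k + 1 + 1) : ℂ) = a2 at *
      generalize (a (k + 1) : ℂ) = a1 at *
      generalize (q : ℂ) ^ (2 * k) = x at *
      field_simp
      grind
    | clear * - hqc hb0 hconj
      generalize (a 1 : ℂ) = a0 at *
      field_simp
      grind
end
end

section
/- Let q ∈ (0,1). On ℓ²(ℤ₊³), let Z₁₁, Z₂₁, Z₂₂ be the unique bounded operators with Z₁₁e_{k,l,m} = q^{2l}√(1−q^{4m+4}) e_{k,l,m+1} − q⁻¹√((1−q^{4k})(1−q^{2l+2})(1−q^{2l+4})) e_{k−1,l+2,m} (the second term being 0 when k = 0), Z₂₁e_{k,l,m} = q^{2k}√(1−q^{2l+2}) e_{k,l+1,m}, and Z₂₂e_{k,l,m} = √(1−q^{4k+4}) e_{k+1,l,m}. Then (Z₁₁, Z₂₁, Z₂₂) satisfies the Pol(Mat₂^sym)_q relations. -/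
open ContinuousLinearMap Complex

noncomputable section

lemma inner_e_left {ι : Type} [DecidableEq ι] (i : ι) (x : L2 ι) : inner ℂ (e i) x = x i := by
  simp [e, lp.inner_single_left]

lemma e_apply {ι : Type} [DecidableEq ι] (i j : ι) : (e i : L2 ι) j = if j = i then 1 else 0 := by
  simp [e, lp.single_apply, Pi.single_apply]

lemma L2.ext_inner {ι : Type} [DecidableEq ι] {x y : L2 ι}
    (h : ∀ i, inner ℂ (e i) x = inner ℂ (e i) y) : x = y := by
  refine lp.ext (funext fun i => ?_)
  simpa only [inner_e_left] using h i

lemma L2.clm_ext {ι : Type} [DecidableEq ι] {S T : L2 ι →L[ℂ] L2 ι}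
    (h : ∀ i, S (e i) = T (e i)) : S = T := by
  apply (adjoint (𝕜 := ℂ) (E := L2 ι) (F := L2 ι)).injective
  ext1 x
  refine L2.ext_inner fun i => ?_
  rw [adjoint_inner_right, adjoint_inner_right, h]

/-- The complex number `√(1 - qⁿ)`. -/
def qSqrt (q : ℝ) (n : ℕ) : ℂ := (Real.sqrt (1 - q ^ n) : ℝ)

lemma qSqrt_zero (q : ℝ) : qSqrt q 0 = 0 := by simp [qSqrt]

lemma qSqrt_sq {q : ℝ} (h0 : 0 ≤ q) (h1 : q ≤ 1) (n : ℕ) :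
    qSqrt q n ^ 2 = 1 - (q : ℂ) ^ n := by
  rw [qSqrt, ← ofReal_pow, Real.sq_sqrt (sub_nonneg.2 (pow_le_one₀ h0 h1))]
  push_cast
  rfl

lemma conj_qSqrt (q : ℝ) (n : ℕ) : (starRingEnd ℂ) (qSqrt q n) = qSqrt q n := conj_ofReal _

section

variable {q : ℝ} {Z : L2 (ℕ × ℕ × ℕ) →L[ℂ] L2 (ℕ × ℕ × ℕ)} {s t : ℕ → ℂ}

lemma adjoint_raise_fst_apply (t0 : t 0 = 0) (tc : ∀ n, (starRingEnd ℂ) (t n) = t n)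
    (h : ∀ k l m : ℕ, Z (e (k, l, m)) = t (k + 1) • e (k + 1, l, m)) (k l m : ℕ) :
    adjoint Z (e (k, l, m)) = t k • e (k - 1, l, m) := by
  refine L2.ext_inner fun ⟨k', l', m'⟩ => ?_
  rw [adjoint_inner_right, h, inner_smul_left, inner_smul_right, tc, inner_e_left, inner_e_left,
    e_apply, e_apply]
  rcases k with _ | k
  · simp [t0]
  · by_cases hk : k' = k <;> simp [hk]

lemma adjoint_raise_snd_apply (s0 : s 0 = 0) (sc : ∀ n, (starRingEnd ℂ) (s n) = s n)
    (h : ∀ k l m : ℕ, Z (e (k, l, m)) = ((q : ℂ) ^ (2 * k) * s (l + 1)) • e (k, l + 1, m))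
    (k l m : ℕ) :
    adjoint Z (e (k, l, m)) = ((q : ℂ) ^ (2 * k) * s l) • e (k, l - 1, m) := by
  refine L2.ext_inner fun ⟨k', l', m'⟩ => ?_
  rw [adjoint_inner_right, h, inner_smul_left, inner_smul_right, inner_e_left, inner_e_left,
    e_apply, e_apply]
  rcases l with _ | l
  · simp [s0]
  · by_cases hk : k' = k <;> by_cases hl : l' = l <;> simp [hk, hl, sc]

lemma adjoint_raise_trd_sub_apply (s0 : s 0 = 0) (t0 : t 0 = 0) (sc : ∀ n, (starRingEnd ℂ) (s n) = s n)
    (tc : ∀ n, (starRingEnd ℂ) (t n) = t n)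
    (h : ∀ k l m : ℕ, Z (e (k, l, m)) = ((q : ℂ) ^ (2 * l) * t (m + 1)) • e (k, l, m + 1)
      - ((q : ℂ)⁻¹ * (t k * s (l + 1) * s (l + 2))) • e (k - 1, l + 2, m)) (k l m : ℕ) :
    adjoint Z (e (k, l, m)) = ((q : ℂ) ^ (2 * l) * t m) • e (k, l, m - 1)
      - ((q : ℂ)⁻¹ * (t (k + 1) * s l * s (l - 1))) • e (k + 1, l - 2, m) := by
  refine L2.ext_inner fun ⟨k', l', m'⟩ => ?_
  rw [adjoint_inner_right, h]
  simp only [inner_sub_left, inner_sub_right, inner_smul_left, inner_smul_right, inner_e_left,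
    e_apply]
  congr 1
  · rcases m with _ | m
    · simp [t0]
    · by_cases hm : m' = m <;> by_cases hl : l' = l <;> simp [hm, hl, tc]
  · rcases k' with _ | k'
    · simp [t0]
    · rcases l with _ | _ | l
      · simp [s0]
      · simp [s0]
      · by_cases hk : k' = k <;> by_cases hl : l' = l <;> simp [hk, hl, sc, tc]
        split_ifs <;> ring

end

set_option maxHeartbeats 4000000 in
/-- For `q ∈ (0,1)`, the operators on `ℓ²(ℤ₊³)` given by
`Z₁₁ e_{k,l,m} = q^{2l}√(1−q^{4m+4}) e_{k,l,m+1} − q⁻¹√((1−q^{4k})(1−q^{2l+2})(1−q^{2l+4})) e_{k−1,l+2,m}`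
(the second term vanishing when `k = 0`), `Z₂₁ e_{k,l,m} = q^{2k}√(1−q^{2l+2}) e_{k,l+1,m}`,
`Z₂₂ e_{k,l,m} = √(1−q^{4k+4}) e_{k+1,l,m}` satisfy the `Pol(Mat₂ˢʸᵐ)_q` relations. -/
theorem stmt5 (q : ℝ) (hq : q ∈ Set.Ioo (0 : ℝ) 1)
    (Z11 Z21 Z22 : L2 (ℕ × ℕ × ℕ) →L[ℂ] L2 (ℕ × ℕ × ℕ))
    (h11 : ∀ k l m : ℕ, Z11 (e (k, l, m)) =
      ((q ^ (2 * l) * Real.sqrt (1 - q ^ (4 * m + 4)) : ℝ) : ℂ) • e (k, l, m + 1)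
      - ((q⁻¹ * Real.sqrt ((1 - q ^ (4 * k)) * (1 - q ^ (2 * l + 2)) * (1 - q ^ (2 * l + 4)))
          : ℝ) : ℂ) • e (k - 1, l + 2, m))
    (h21 : ∀ k l m : ℕ, Z21 (e (k, l, m)) =
      ((q ^ (2 * k) * Real.sqrt (1 - q ^ (2 * l + 2)) : ℝ) : ℂ) • e (k, l + 1, m))
    (h22 : ∀ k l m : ℕ, Z22 (e (k, l, m)) =
      ((Real.sqrt (1 - q ^ (4 * k + 4)) : ℝ) : ℂ) • e (k + 1, l, m)) :
    PolMat2SymRel q Z11 Z21 Z22 := by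
  obtain ⟨h0, h1⟩ := hq
  set s : ℕ → ℂ := fun n => qSqrt q (2 * n) with hs
  set t : ℕ → ℂ := fun n => qSqrt q (4 * n) with ht
  have hq0 : (q : ℂ) ≠ 0 := ofReal_ne_zero.2 h0.ne'
  have s0 : s 0 = 0 := qSqrt_zero q
  have t0 : t 0 = 0 := qSqrt_zero q
  have sc (n) : (starRingEnd ℂ) (s n) = s n := conj_qSqrt q _
  have tc (n) : (starRingEnd ℂ) (t n) = t n := conj_qSqrt q _
  have s2 (n) : s n ^ 2 = 1 - (q : ℂ) ^ (2 * n) := qSqrt_sq h0.le h1.le _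
  have t2 (n) : t n ^ 2 = 1 - (q : ℂ) ^ (4 * n) := qSqrt_sq h0.le h1.le _
  have g11 (k l m : ℕ) : Z11 (e (k, l, m)) = ((q : ℂ) ^ (2 * l) * t (m + 1)) • e (k, l, m + 1)
      - ((q : ℂ)⁻¹ * (t k * s (l + 1) * s (l + 2))) • e (k - 1, l + 2, m) := by
    rw [h11, Real.sqrt_mul (mul_nonneg _ _), Real.sqrt_mul]
    · simp [hs, ht, qSqrt, mul_add]
    all_goals exact sub_nonneg.2 (pow_le_one₀ h0.le h1.le)
  have g21 (k l m : ℕ) :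
      Z21 (e (k, l, m)) = ((q : ℂ) ^ (2 * k) * s (l + 1)) • e (k, l + 1, m) := by
    rw [h21]; simp [hs, qSqrt, mul_add]
  have g22 (k l m : ℕ) : Z22 (e (k, l, m)) = t (k + 1) • e (k + 1, l, m) := by
    rw [h22]; simp [ht, qSqrt, mul_add]
  have a11 := adjoint_raise_trd_sub_apply s0 t0 sc tc g11
  have a21 := adjoint_raise_snd_apply s0 sc g21
  have a22 := adjoint_raise_fst_apply t0 tc g22
  clear_value s t
  clear hs ht h11 h21 h22
  refine ⟨?_, ?_, ?_, ?_, ?_, ?_, ?_, ?_, ?_⟩ <;> refine L2.clm_ext fun ⟨k, l, m⟩ => ?_ <;>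
    rcases k with _ | k <;> rcases l with _ | _ | l <;> rcases m with _ | m <;>
    simp [g11, g21, g22, a11, a21, a22, s0, t0] <;> try match_scalars
  all_goals
    try field_simp
    try ring_nf
    try
      simp only [s2, t2]
      ring
end
end

section
/- Let t ∈ (0,1). On ℓ²(ℤ₊), let T be the unique bounded operator with Te_k = √(1−t^{2k+2}) e_{k+1}. Then T*T = t²·TT* + (1−t²)·I, and T is irreducible in the sense that every bounded operator on ℓ²(ℤ₊) commuting with both T and T* is a scalar multiple of the identity. -/
open ContinuousLinearMap Complex

noncomputable section

/-- A family of bounded operators acts irreducibly if every bounded operator commuting with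
all members of the family and with all their adjoints is a scalar multiple of the identity. -/
def IsIrreducibleFamily {H : Type} [NormedAddCommGroup H] [InnerProductSpace ℂ H]
    [CompleteSpace H] (Z : Set (H →L[ℂ] H)) : Prop :=
  ∀ T : H →L[ℂ] H,
    (∀ A ∈ Z, T * A = A * T ∧ T * adjoint A = adjoint A * T) →
    ∃ c : ℂ, T = c • (1 : H →L[ℂ] H)

theorem ext_e {ι : Type} [DecidableEq ι] {A B : L2 ι →L[ℂ] L2 ι}
    (h : ∀ i, A (e i) = B (e i)) : A = B := by
  refine lp.ext_continuousLinearMap (by norm_num) fun i => ?_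
  ext1
  simpa [e] using h i

theorem e_succ_apply_succ (k j : ℕ) : (e (k + 1) : L2 ℕ) (j + 1) = (e k : L2 ℕ) j := by
  simp [e, lp.single_apply, Pi.single_apply]

section WeightedShift

variable {w : ℕ → ℝ} {T : L2 ℕ →L[ℂ] L2 ℕ}

/-- The adjoint of a weighted shift, in coordinates. -/
theorem adjoint_weightedShift_apply (hT : ∀ k, T (e k) = (w k : ℂ) • e (k + 1))
    (x : L2 ℕ) (k : ℕ) : adjoint T x k = w k * x (k + 1) := by
  have h : inner ℂ (e k) (adjoint T x) = inner ℂ (T (e k)) x := adjoint_inner_right T (e k) x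
  rw [hT, inner_smul_left, e, e, lp.inner_single_left, lp.inner_single_left] at h
  simpa using h

theorem adjoint_weightedShift_e_zero (hT : ∀ k, T (e k) = (w k : ℂ) • e (k + 1)) :
    adjoint T (e 0) = 0 := by
  ext j
  rw [adjoint_weightedShift_apply hT]
  simp [e, lp.single_apply]

theorem adjoint_weightedShift_e_succ (hT : ∀ k, T (e k) = (w k : ℂ) • e (k + 1)) (k : ℕ) :
    adjoint T (e (k + 1)) = (w k : ℂ) • e k := by
  ext j
  rw [adjoint_weightedShift_apply hT, e_succ_apply_succ, lp.coeFn_smul, Pi.smul_apply, smul_eq_mul]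
  obtain rfl | hjk := eq_or_ne j k
  · rfl
  · simp [e, lp.single_apply, hjk]

/-- A weighted shift with nonvanishing weights is irreducible. -/
theorem isIrreducibleFamily_weightedShift (hw : ∀ k, w k ≠ 0)
    (hT : ∀ k, T (e k) = (w k : ℂ) • e (k + 1)) : IsIrreducibleFamily {T} := by
  intro S hS
  obtain ⟨hST, hST'⟩ := hS T rfl
  refine ⟨S (e 0) 0, ext_e fun k => ?_⟩
  induction k with
  | zero =>
    have h : adjoint T (S (e 0)) = 0 := by
      rw [← mul_apply_eq_comp, ← hST', mul_apply_eq_comp, adjoint_weightedShift_e_zero hT, map_zero]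
    ext j
    cases j with
    | zero => simp [e]
    | succ j =>
      have hj := adjoint_weightedShift_apply hT (S (e 0)) j
      rw [h] at hj
      have : S (e 0) (j + 1) = 0 := by simpa [hw j] using hj
      rw [this, smul_apply, one_apply_eq_self]
      simp [e, lp.single_apply]
  | succ k ih =>
    have h : S (T (e k)) = T (S (e k)) := DFunLike.congr_fun hST (e k)
    rw [ih, smul_apply, one_apply_eq_self, map_smul, hT, map_smul, smul_comm] at h
    exact smul_right_injective _ (ofReal_ne_zero.2 (hw k)) h

end WeightedShift

/-- For `t ∈ (0,1)`, the Fock representation of the `q`-oscillator algebra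
`Pol(ℂ)_t` on `ℓ²(ℤ₊)`, given by `T e_k = √(1−t^{2k+2}) e_{k+1}`, satisfies
`T*T = t²TT* + (1−t²)I` and is irreducible. -/
theorem stmt16 (t : ℝ) (ht : t ∈ Set.Ioo (0 : ℝ) 1)
    (T : L2 ℕ →L[ℂ] L2 ℕ)
    (hT : ∀ k : ℕ, T (e k) = ((Real.sqrt (1 - t ^ (2 * k + 2)) : ℝ) : ℂ) • e (k + 1)) :
    adjoint T * T =
        (t : ℂ) ^ 2 • (T * adjoint T) + (1 - (t : ℂ) ^ 2) • (1 : L2 ℕ →L[ℂ] L2 ℕ) ∧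
      IsIrreducibleFamily {T} := by
  have hw : ∀ k : ℕ, Real.sqrt (1 - t ^ (2 * k + 2)) ≠ 0 := fun k =>
    (Real.sqrt_pos.2 (sub_pos.2 (pow_lt_one₀ ht.1.le ht.2 (by omega)))).ne'
  have hw_sq : ∀ k : ℕ, ((Real.sqrt (1 - t ^ (2 * k + 2)) : ℝ) : ℂ) *
      ((Real.sqrt (1 - t ^ (2 * k + 2)) : ℝ) : ℂ) = 1 - (t : ℂ) ^ (2 * k + 2) := fun k => by
    rw [← ofReal_mul, Real.mul_self_sqrt (sub_nonneg.2 (pow_le_one₀ ht.1.le ht.2.le))]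
    push_cast
    rfl
  refine ⟨ext_e fun k => ?_, isIrreducibleFamily_weightedShift hw hT⟩
  cases k with
  | zero =>
    simp only [mul_apply_eq_comp, add_apply, smul_apply, one_apply_eq_self, hT, map_smul, map_zero,
      adjoint_weightedShift_e_zero hT, adjoint_weightedShift_e_succ hT, smul_smul, hw_sq]
    simp
  | succ k =>
    simp only [mul_apply_eq_comp, add_apply, smul_apply, one_apply_eq_self, hT, map_smul,
      adjoint_weightedShift_e_succ hT, smul_smul, hw_sq, ← add_smul]
    congr 1
    ring
end
end
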